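/- arXiv:math/0212109 — 3 statements merged into one kernel-verified Lean document; each statement's English description precedes it below -/
import Mathlib

section
/- Let k be a field and let V₁ →{f} V₂ →{g} V₃ be a complex (i.e. g ∘ f = 0) of finite-dimensional k-vector spaces, with dual complex V₃* →{g*} V₂* →{f*} V₁*. Let ⟨,⟩ be a nondegenerate symmetric bilinear form on V₂ and let φ : V₂ → V₂* be the induced identification, φ(x) = ⟨x, ·⟩. Assume φ(Im f) ⊆ Im g*. Then φ induces a well-defined linear map Ker g / Im f → Ker f* / Im g* on cohomology, and this map is an isomorphism if and only if Ker g ∩ φ⁻¹(Im g*) ⊆ Im f. -/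
set_option maxSynthPendingDepth 2

/-- **Lemma 4.2 (linear algebra lemma).** Let `V₁ →f V₂ →g V₃` be a complex of
finite-dimensional vector spaces over a field `k`, with dual complex
`V₃* →g* V₂* →f* V₁*`. Let `B` be a nondegenerate symmetric bilinear form on `V₂`,
inducing `φ : V₂ → V₂*`, `φ x = B x`. If `φ (Im f) ⊆ Im g*` then `φ` induces a linear
map `Ker g / Im f → Ker f* / Im g*`, and this map is an isomorphism if and only if
`Ker g ∩ φ⁻¹(Im g*) ⊆ Im f`. -/
theorem stmt0 {k : Type*} [Field k]
    {V₁ V₂ V₃ : Type*} [AddCommGroup V₁] [Module k V₁]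
    [AddCommGroup V₂] [Module k V₂] [AddCommGroup V₃] [Module k V₃]
    [FiniteDimensional k V₁] [FiniteDimensional k V₂] [FiniteDimensional k V₃]
    (f : V₁ →ₗ[k] V₂) (g : V₂ →ₗ[k] V₃)
    (hcomplex : g ∘ₗ f = 0)
    (B : V₂ →ₗ[k] V₂ →ₗ[k] k)
    (hsymm : ∀ x y, B x y = B y x)
    (hnondeg : ∀ x, (∀ y, B x y = 0) → x = 0)
    (himf : ∀ x ∈ LinearMap.range f, B x ∈ LinearMap.range g.dualMap) :
    ∃ Φ : (LinearMap.ker g ⧸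
            (LinearMap.range f).comap (LinearMap.ker g).subtype) →ₗ[k]
          (LinearMap.ker f.dualMap ⧸
            (LinearMap.range g.dualMap).comap (LinearMap.ker f.dualMap).subtype),
      (∀ (x : LinearMap.ker g) (hx : B x.val ∈ LinearMap.ker f.dualMap),
        Φ (Submodule.Quotient.mk x) = Submodule.Quotient.mk ⟨B x.val, hx⟩) ∧
      (Function.Bijective Φ ↔
        ∀ x, x ∈ LinearMap.ker g → B x ∈ LinearMap.range g.dualMap →
          x ∈ LinearMap.range f) := by
  have hgf : ∀ v, g (f v) = 0 := fun v => LinearMap.congr_fun hcomplex v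
  have hker : ∀ x : LinearMap.ker g, B x.val ∈ LinearMap.ker f.dualMap := by
    intro x
    rw [LinearMap.mem_ker]
    ext v
    obtain ⟨ξ, hξ⟩ := himf (f v) ⟨v, rfl⟩
    have h1 : B (f v) x.val = ξ (g x.val) := by
      rw [← hξ]; rfl
    have h2 : g x.val = 0 := x.2
    rw [LinearMap.dualMap_apply, hsymm, h1, h2]
    simp
  have hle1 : LinearMap.range f ≤ LinearMap.ker g := by
    rintro _ ⟨v, rfl⟩
    exact hgf v
  have hle2 : LinearMap.range g.dualMap ≤ LinearMap.ker f.dualMap := by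
    rintro _ ⟨ξ, rfl⟩
    rw [LinearMap.mem_ker]
    ext v
    simp [LinearMap.dualMap_apply, hgf]
  let ψ : LinearMap.ker g →ₗ[k] LinearMap.ker f.dualMap :=
    LinearMap.codRestrict (LinearMap.ker f.dualMap)
      ((B : V₂ →ₗ[k] Module.Dual k V₂) ∘ₗ (LinearMap.ker g).subtype) hker
  have hψ : (LinearMap.range f).comap (LinearMap.ker g).subtype ≤
      ((LinearMap.range g.dualMap).comap (LinearMap.ker f.dualMap).subtype).comap ψ := by
    intro x hx
    exact himf x.val hx
  let Φ := Submodule.mapQ _ _ ψ hψ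
  have hinj : Function.Injective Φ ↔
        ∀ x, x ∈ LinearMap.ker g → B x ∈ LinearMap.range g.dualMap →
          x ∈ LinearMap.range f := by
    rw [injective_iff_map_eq_zero]
    constructor
    · intro h x hx hB
      have h1 := h (Submodule.Quotient.mk ⟨x, hx⟩)
        ((Submodule.Quotient.mk_eq_zero _).2 hB)
      have h2 := (Submodule.Quotient.mk_eq_zero _).1 h1
      exact h2
    · intro h a ha
      obtain ⟨x, rfl⟩ := Submodule.Quotient.mk_surjective _ a
      have ha' : (Submodule.Quotient.mk (ψ x) : LinearMap.ker f.dualMap ⧸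
          (LinearMap.range g.dualMap).comap (LinearMap.ker f.dualMap).subtype) = 0 := ha
      have h2 := (Submodule.Quotient.mk_eq_zero _).1 ha'
      exact (Submodule.Quotient.mk_eq_zero _).2 (h x.val x.2 h2)
  have hdim : Module.finrank k (LinearMap.ker g ⧸
            (LinearMap.range f).comap (LinearMap.ker g).subtype) =
      Module.finrank k (LinearMap.ker f.dualMap ⧸
            (LinearMap.range g.dualMap).comap (LinearMap.ker f.dualMap).subtype) := by
    have a1 := Submodule.finrank_quotient_add_finrank
      ((LinearMap.range f).comap (LinearMap.ker g).subtype)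
    have a2 := Submodule.finrank_quotient_add_finrank
      ((LinearMap.range g.dualMap).comap (LinearMap.ker f.dualMap).subtype)
    have b1 := (Submodule.comapSubtypeEquivOfLe hle1).finrank_eq
    have b2 := (Submodule.comapSubtypeEquivOfLe hle2).finrank_eq
    have c1 := LinearMap.finrank_range_add_finrank_ker g
    have c2 := LinearMap.finrank_range_add_finrank_ker f.dualMap
    have d1 := LinearMap.finrank_range_dualMap_eq_finrank_range f
    have d2 := LinearMap.finrank_range_dualMap_eq_finrank_range g
    have e : Module.finrank k (Module.Dual k V₂) = Module.finrank k V₂ :=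
      Subspace.dual_finrank_eq
    omega
  refine ⟨Φ, fun x hx => rfl, ?_⟩
  rw [← hinj]
  exact ⟨fun h => h.1, fun h =>
    ⟨h, (LinearMap.injective_iff_surjective_of_finrank_eq_finrank hdim).1 h⟩⟩
end

section
/- Let k be a field and let B⁰, C⁰, D⁰, A², B², C², A⁴ be k-vector spaces with linear maps τ₀ : B⁰ → A², ρ₀ : B⁰ → C⁰, ρ₁ : C⁰ → D⁰, τ₁ : C⁰ → B², ρ₂ : A² → B², τ₂ : B² → A⁴, ρ₃ : B² → C², τ₃ : D⁰ → C², satisfying: (i) τ₂ ∘ τ₁ = 0; (ii) ρ₁ ∘ ρ₀ = 0; (iii) τ₁ ∘ ρ₀ = −ρ₂ ∘ τ₀; (iv) τ₃ ∘ ρ₁ = −ρ₃ ∘ τ₁; and (v) Ker τ₂ ∩ Im ρ₂ ⊆ Im(ρ₂ ∘ τ₀). Then for all a ∈ A² and c ∈ C⁰ such that τ₂(ρ₂(a) + τ₁(c)) = 0 and ρ₃(ρ₂(a) + τ₁(c)) + τ₃(ρ₁(c)) = 0, there exists c′ ∈ C⁰ with τ₁(c′) = ρ₂(a) + τ₁(c)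 and ρ₁(c′) = ρ₁(c). In other words, the element (ρ₂(a) + τ₁(c), ρ₁(c)) of B² ⊕ D⁰ lies in the image of the map C⁰ → B² ⊕ D⁰ sending c′ to (τ₁(c′), ρ₁(c′)). -/
/-- **The diagram chase deducing `N : E₂^{−1,4} ≅ E₂^{1,2}` from the key lemma.**
Given vector spaces `B⁰, C⁰, D⁰, A², B², C², A⁴` over a field `k` and linear maps
`τ₀ : B⁰ → A²`, `ρ₀ : B⁰ → C⁰`, `ρ₁ : C⁰ → D⁰`, `τ₁ : C⁰ → B²`, `ρ₂ : A² → B²`,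
`τ₂ : B² → A⁴`, `ρ₃ : B² → C²`, `τ₃ : D⁰ → C²` satisfying
(i) `τ₂ ∘ τ₁ = 0`, (ii) `ρ₁ ∘ ρ₀ = 0`, (iii) `τ₁ ∘ ρ₀ = −ρ₂ ∘ τ₀`,
(iv) `τ₃ ∘ ρ₁ = −ρ₃ ∘ τ₁`, and (v) `Ker τ₂ ∩ Im ρ₂ ⊆ Im (ρ₂ ∘ τ₀)`, then for all
`a ∈ A²`, `c ∈ C⁰` with `τ₂(ρ₂ a + τ₁ c) = 0` and `ρ₃(ρ₂ a + τ₁ c) + τ₃(ρ₁ c) = 0`,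
there exists `c′ ∈ C⁰` with `τ₁ c′ = ρ₂ a + τ₁ c` and `ρ₁ c′ = ρ₁ c`. -/
theorem stmt4 {k : Type*} [Field k]
    {B0 C0 D0 A2 B2 C2 A4 : Type*}
    [AddCommGroup B0] [Module k B0] [AddCommGroup C0] [Module k C0]
    [AddCommGroup D0] [Module k D0] [AddCommGroup A2] [Module k A2]
    [AddCommGroup B2] [Module k B2] [AddCommGroup C2] [Module k C2]
    [AddCommGroup A4] [Module k A4]
    (τ₀ : B0 →ₗ[k] A2) (ρ₀ : B0 →ₗ[k] C0) (ρ₁ : C0 →ₗ[k] D0) (τ₁ : C0 →ₗ[k] B2)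
    (ρ₂ : A2 →ₗ[k] B2) (τ₂ : B2 →ₗ[k] A4) (ρ₃ : B2 →ₗ[k] C2) (τ₃ : D0 →ₗ[k] C2)
    (h1 : τ₂ ∘ₗ τ₁ = 0)
    (h2 : ρ₁ ∘ₗ ρ₀ = 0)
    (h3 : τ₁ ∘ₗ ρ₀ = -(ρ₂ ∘ₗ τ₀))
    (h4 : τ₃ ∘ₗ ρ₁ = -(ρ₃ ∘ₗ τ₁))
    (h5 : LinearMap.ker τ₂ ⊓ LinearMap.range ρ₂ ≤ LinearMap.range (ρ₂ ∘ₗ τ₀)) :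
    ∀ (a : A2) (c : C0),
      τ₂ (ρ₂ a + τ₁ c) = 0 →
      ρ₃ (ρ₂ a + τ₁ c) + τ₃ (ρ₁ c) = 0 →
      ∃ c' : C0, τ₁ c' = ρ₂ a + τ₁ c ∧ ρ₁ c' = ρ₁ c := by
  intro a c ha _
  have e1 : τ₂ (τ₁ c) = 0 := LinearMap.congr_fun h1 c
  have hk : τ₂ (ρ₂ a) = 0 := by
    rw [map_add, e1, add_zero] at ha
    exact ha
  obtain ⟨b, hb⟩ := h5 ⟨hk, a, rfl⟩
  have hb2 : ρ₂ (τ₀ b) = ρ₂ a := hb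
  have e2 : ρ₁ (ρ₀ b) = 0 := LinearMap.congr_fun h2 b
  have e3 : τ₁ (ρ₀ b) = -ρ₂ (τ₀ b) := LinearMap.congr_fun h3 b
  refine ⟨c - ρ₀ b, ?_, ?_⟩
  · rw [map_sub, e3, hb2, sub_neg_eq_add, add_comm]
  · rw [map_sub, e2, sub_zero]
end

section
/- Let k be a field and let U, A, B, A′, B′ be finite-dimensional k-vector spaces with linear maps τ₀ : U → A, ρ₂ : A → B, τ₂ : B → A′, ρ₄ : A′ → B′, L : A → A′, L_B : B → B′, a symmetric bilinear form β on B, a bilinear pairing π : A × A′ → k, and a bilinear pairing π′ : U × B′ → k. Let S ⊆ Im τ₀ and R⁰ ⊆ Im ρ₂ be subspaces. Assume: (i) β(ρ₂(a), w) = π(a, τ₂(w)) for all a ∈ A, w ∈ B; (ii) π(τ₀(u), z) = π′(u, ρ₄(z)) for all u ∈ U, z ∈ A′; (iii) ρ₄ ∘ L = L_B ∘ ρ₂; (iv) τ₂ ∘ ρ₂ ∘ τ₀ = 0; (v) the bilinear form (r, r′) ↦ β(r, r′) is nondegenerate on R⁰; (vi) the bilinear form q(x, y) := π(x, L(y)) is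 symmetric on A and its restriction to S is nondegenerate. Then the map S → Im ρ₂ / R⁰ induced by ρ₂ is injective; that is, if x ∈ S and ρ₂(x) ∈ R⁰, then x = 0. -/
/-- **Abstract form of Claim 4.7 (Claim 4) in the proof of the key lemma.**
Let `U, A, B, A′, B′` be finite-dimensional vector spaces over a field `k`, with
maps `τ₀ : U → A`, `ρ₂ : A → B`, `τ₂ : B → A′`, `ρ₄ : A′ → B′`, `L : A → A′`,
`L_B : B → B′`, a symmetric bilinear form `β` on `B`, pairings `π : A × A′ → k`
and `π′ : U × B′ → k`, and subspaces `S ⊆ Im τ₀`, `R⁰ ⊆ Im ρ₂`. Assume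
(i) `β(ρ₂ a, w) = π(a, τ₂ w)`; (ii) `π(τ₀ u, z) = π′(u, ρ₄ z)`;
(iii) `ρ₄ ∘ L = L_B ∘ ρ₂`; (iv) `τ₂ ∘ ρ₂ ∘ τ₀ = 0`; (v) `β` is nondegenerate on
`R⁰`; (vi) `q(x,y) := π(x, L y)` is symmetric on `A` and nondegenerate on `S`.
Then the map `S → Im ρ₂ / R⁰` induced by `ρ₂` is injective: if `x ∈ S` and
`ρ₂ x ∈ R⁰`, then `x = 0`. -/
theorem stmt8 {k : Type*} [Field k]
    {U A B A' B' : Type*}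
    [AddCommGroup U] [Module k U] [AddCommGroup A] [Module k A]
    [AddCommGroup B] [Module k B] [AddCommGroup A'] [Module k A']
    [AddCommGroup B'] [Module k B']
    [FiniteDimensional k U] [FiniteDimensional k A] [FiniteDimensional k B]
    [FiniteDimensional k A'] [FiniteDimensional k B']
    (τ₀ : U →ₗ[k] A) (ρ₂ : A →ₗ[k] B) (τ₂ : B →ₗ[k] A') (ρ₄ : A' →ₗ[k] B')
    (L : A →ₗ[k] A') (LB : B →ₗ[k] B')
    (β : B →ₗ[k] B →ₗ[k] k)
    (hβsymm : ∀ w w', β w w' = β w' w)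
    (π : A →ₗ[k] A' →ₗ[k] k) (π' : U →ₗ[k] B' →ₗ[k] k)
    (S : Submodule k A) (R0 : Submodule k B)
    (hS : S ≤ LinearMap.range τ₀)
    (hR0 : R0 ≤ LinearMap.range ρ₂)
    (hadj1 : ∀ (a : A) (w : B), β (ρ₂ a) w = π a (τ₂ w))
    (hadj2 : ∀ (u : U) (z : A'), π (τ₀ u) z = π' u (ρ₄ z))
    (hcomm : ρ₄ ∘ₗ L = LB ∘ₗ ρ₂)
    (hzero : τ₂ ∘ₗ ρ₂ ∘ₗ τ₀ = 0)
    (hβnondeg : ∀ r ∈ R0, (∀ r' ∈ R0, β r r' = 0) → r = 0)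
    (hqsymm : ∀ x y : A, π x (L y) = π y (L x))
    (hqnondeg : ∀ x ∈ S, (∀ y ∈ S, π x (L y) = 0) → x = 0) :
    ∀ x ∈ S, ρ₂ x ∈ R0 → x = 0 := by
  intro x hx hxR
  have hρ : ρ₂ x = 0 := by
    apply hβnondeg _ hxR
    intro r' hr'
    obtain ⟨a, rfl⟩ := hR0 hr'
    obtain ⟨u, rfl⟩ := hS hx
    have h0 : τ₂ (ρ₂ (τ₀ u)) = 0 := by
      simpa using LinearMap.congr_fun hzero u
    rw [hβsymm, hadj1, h0, map_zero]
  apply hqnondeg x hx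
  intro y hy
  obtain ⟨v, rfl⟩ := hS hy
  have h1 : ρ₄ (L x) = LB (ρ₂ x) := by
    simpa using LinearMap.congr_fun hcomm x
  rw [hqsymm, hadj2, h1, hρ, map_zero, map_zero]
end
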